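/- Let X₀, X₁ be real Banach spaces and ι : X₀ → X₁ a compact embedding. Let T > 0, p ∈ (1,∞) and α ∈ (0,1) with αp > 1. Then for every sequence (f_n) of strongly measurable functions f_n : [0,T] → X₀ satisfying sup_n ( ‖f_n‖_{L^p(0,T;X₀)} + [f_n]_{W^{α,p}(0,T;X₀)} ) < ∞, there exist continuous functions g_n : [0,T] → X₁ with g_n(t) = ι(f_n(t)) for almost every t ∈ [0,T], and a subsequence (g_{n_k}) converging uniformly on [0,T] to a continuous function g : [0,T] → X₁. -/

import Mathlib

open MeasureTheory
open scoped ENNReal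

lemma fg_select (J : Set ℝ) (r : ℝ) (hr : 0 < r)
    (hJ : ENNReal.ofReal r ≤ volume J) (g : Fin 3 → ℝ → ℝ≥0∞) (hg : ∀ i, Measurable (g i))
    (b : Fin 3 → ℝ) (hb : ∀ i, 0 < b i)
    (hgb : ∀ i, ∫⁻ y in J, g i y ≤ ENNReal.ofReal (b i)) :
    ∃ y ∈ J, ∀ i, g i y ≤ ENNReal.ofReal (4 * b i / r) := by
  by_contra! hcon
  have h1 : ∀ i, (volume.restrict J) {y | ENNReal.ofReal (4 * b i / r) ≤ g i y}
      ≤ ENNReal.ofReal (r / 4) := by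
    intro i
    have hpos : 0 < 4 * b i / r := by have := hb i; positivity
    refine (meas_ge_le_lintegral_div (hg i).aemeasurable (by simpa using hpos) (by simp)).trans ?_
    refine (ENNReal.div_le_div_right (hgb i) _).trans ?_
    rw [← ENNReal.ofReal_div_of_pos hpos]
    apply ENNReal.ofReal_le_ofReal
    have := hb i
    apply le_of_eq
    field_simp
  have h2 : (volume.restrict J) Set.univ ≤
      ∑ i : Fin 3, (volume.restrict J) {y | ENNReal.ofReal (4 * b i / r) ≤ g i y} := by
    have hm : MeasurableSet (⋃ i : Fin 3, {y | ENNReal.ofReal (4 * b i / r) ≤ g i y}) :=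
      MeasurableSet.iUnion fun i => measurableSet_le measurable_const (hg i)
    have : (volume.restrict J) Set.univ ≤
        (volume.restrict J) (⋃ i : Fin 3, {y | ENNReal.ofReal (4 * b i / r) ≤ g i y}) := by
      rw [Measure.restrict_apply_univ, Measure.restrict_apply hm]
      apply measure_mono
      intro y hy
      obtain ⟨i, hi⟩ := hcon y hy
      exact ⟨Set.mem_iUnion.2 ⟨i, hi.le⟩, hy⟩
    exact this.trans (measure_iUnion_fintype_le _ _)
  rw [Measure.restrict_apply_univ] at h2
  have h3 := hJ.trans (h2.trans (Finset.sum_le_sum fun i _ => h1 i))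
  rw [← ENNReal.ofReal_sum_of_nonneg (fun i _ => by positivity)] at h3
  rw [ENNReal.ofReal_le_ofReal_iff (by positivity)] at h3
  simp at h3
  linarith

lemma fg_ptwise {X : Type*} [NormedAddCommGroup X] (f : ℝ → X) (p q c ρ x y : ℝ) (hp : 0 < p)
    (hq : 0 < q) (hc : 0 ≤ c) (hρ : |x - y| ≤ ρ)
    (h : (‖f x - f y‖₊ : ℝ≥0∞) ^ p / ENNReal.ofReal (|x - y| ^ q) ≤ ENNReal.ofReal c) :
    ‖f x - f y‖ ≤ (c * ρ ^ q) ^ (1 / p) := by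
  have hρ0 : 0 ≤ ρ := (abs_nonneg _).trans hρ
  rcases eq_or_ne x y with rfl | hxy
  · simp; positivity
  have hpos : 0 < |x - y| := abs_pos.2 (sub_ne_zero.2 hxy)
  have hpos' : 0 < |x - y| ^ q := by positivity
  rw [ENNReal.div_le_iff (by simpa using hpos') (by simp), ← ENNReal.ofReal_mul hc] at h
  have h2 : (‖f x - f y‖₊ : ℝ≥0∞) = ENNReal.ofReal ‖f x - f y‖ := by
    rw [ofReal_norm]; rfl
  rw [h2, ENNReal.ofReal_rpow_of_nonneg (norm_nonneg _) hp.le,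
    ENNReal.ofReal_le_ofReal_iff (by positivity)] at h
  have h3 : ‖f x - f y‖ ^ p ≤ c * ρ ^ q := h.trans (by gcongr)
  calc ‖f x - f y‖ = (‖f x - f y‖ ^ p) ^ (1 / p) := by
        rw [← Real.rpow_mul (norm_nonneg _)]; field_simp; simp
    _ ≤ _ := by gcongr

lemma fg_chain {X : Type*} [NormedAddCommGroup X] (f : ℝ → X) (hf : StronglyMeasurable f)
    (S : Set ℝ) (p α B : ℝ) (hp : 1 < p) (hαp : 1 < α * p) (hB : 0 < B)
    (D : ℝ → ℝ≥0∞) (hD : D = fun t => ∫⁻ s in S, ((‖f t - f s‖₊ : ℝ≥0∞) ^ p /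
            ENNReal.ofReal (|t - s| ^ (1 + α * p))))
    (hDB : ∫⁻ t in S, D t ≤ ENNReal.ofReal B)
    (t : ℝ) (ht : D t ≠ ⊤) (J : ℕ → Set ℝ) (h : ℝ) (hh : 0 < h)
    (hJS : ∀ k, J k ⊆ S) (hJv : ∀ k, ENNReal.ofReal (h / 2 ^ k) ≤ volume (J k))
    (hJt : ∀ k, ∀ y ∈ J k, |y - t| ≤ h / 2 ^ k)
    (x : ℝ) (hx : x ∈ J 0) (hDx : D x ≤ ENNReal.ofReal (4 * B / h)) :
    ‖f t - f x‖ ≤ (32 * B * 2 ^ (1 + α * p)) ^ (1 / p) * (1 - (1 / 2) ^ (α - 1 / p))⁻¹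
      * h ^ (α - 1 / p) := by
  set q := 1 + α * p with hq
  set β := α - 1 / p with hβ
  set C := (32 * B * 2 ^ q) ^ (1 / p) with hC
  have hp0 : 0 < p := by linarith
  have hq0 : 0 < q := by linarith
  have hβ0 : 0 < β := by
    have : 1 / p < α := by rw [div_lt_iff₀ hp0]; exact hαp
    linarith
  have hC0 : 0 ≤ C := by positivity
  have hkm : Measurable (Function.uncurry fun t s : ℝ => ((‖f t - f s‖₊ : ℝ≥0∞) ^ p /
            ENNReal.ofReal (|t - s| ^ q))) := by
    have h1 : StronglyMeasurable (fun z : ℝ × ℝ => f z.1 - f z.2) :=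
      (hf.comp_measurable measurable_fst).sub (hf.comp_measurable measurable_snd)
    have h2 : Measurable fun z : ℝ × ℝ => (‖f z.1 - f z.2‖₊ : ℝ≥0∞) := h1.enorm
    have h3 : Measurable fun z : ℝ × ℝ => ENNReal.ofReal (|z.1 - z.2| ^ q) := by fun_prop
    exact (h2.pow_const p).div h3
  have hDm : Measurable D := by
    rw [hD]
    exact hkm.lintegral_prod_right
  obtain ⟨d, hd0, hd⟩ : ∃ d : ℝ, 0 < d ∧ D t ≤ ENNReal.ofReal d := by
    refine ⟨(D t).toReal + 1, by positivity, ?_⟩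
    rw [ENNReal.le_ofReal_iff_toReal_le ht (by positivity)]
    linarith
  have key : ∀ k : ℕ, ∃ y ∈ J (k + 1), D y ≤ ENNReal.ofReal (4 * B / (h / 2 ^ (k + 1))) ∧
      ‖f x - f y‖ ≤ ∑ i ∈ Finset.range (k + 1), C * (h / 2 ^ i) ^ β ∧
      ‖f t - f y‖ ≤ (4 * d / (h / 2 ^ (k + 1)) * (h / 2 ^ (k + 1)) ^ q) ^ (1 / p) := by
    have step : ∀ (k : ℕ) (z : ℝ), z ∈ J k → D z ≤ ENNReal.ofReal (4 * B / (h / 2 ^ k)) →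
      ∃ y ∈ J (k + 1), D y ≤ ENNReal.ofReal (4 * B / (h / 2 ^ (k + 1))) ∧
      ‖f z - f y‖ ≤ C * (h / 2 ^ k) ^ β ∧
      ‖f t - f y‖ ≤ (4 * d / (h / 2 ^ (k + 1)) * (h / 2 ^ (k + 1)) ^ q) ^ (1 / p) := by
      intro k z hz hDz
      have hmem := fg_select (J (k + 1)) (h / 2 ^ (k + 1)) (by positivity) (hJv _)
        ![D, fun s => ((‖f z - f s‖₊ : ℝ≥0∞) ^ p / ENNReal.ofReal (|z - s| ^ q)),
          fun s => ((‖f t - f s‖₊ : ℝ≥0∞) ^ p / ENNReal.ofReal (|t - s| ^ q))]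
        (by
          intro i
          fin_cases i
          · exact hDm
          · exact hkm.of_uncurry_left
          · exact hkm.of_uncurry_left)
        ![B, 4 * B / (h / 2 ^ k), d]
        (by
          intro i
          fin_cases i
          · exact hB
          · show 0 < 4 * B / (h / 2 ^ k); positivity
          · exact hd0)
        (by
          intro i
          fin_cases i
          · exact (lintegral_mono_set (hJS _)).trans hDB
          · refine (lintegral_mono_set (hJS _)).trans ?_
            rw [hD] at hDz; exact hDz
          · refine (lintegral_mono_set (hJS _)).trans ?_
            rw [hD] at hd; exact hd)
      obtain ⟨y, hy, hyi⟩ := hmem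
      have e0 := hyi 0
      have e1 := hyi 1
      have e2 := hyi 2
      simp only [Matrix.cons_val] at e0 e1 e2
      have hyt := hJt _ y hy
      have hzt := hJt _ z hz
      refine ⟨y, hy, e0, ?_, ?_⟩
      · set r := h / 2 ^ k with hr
        have hr0 : 0 < r := by positivity
        have hr2 : h / 2 ^ (k + 1) = r / 2 := by rw [hr, pow_succ]; field_simp
        rw [hr2] at e1 hyt
        have := fg_ptwise f p q _ (2 * r) z y hp0 hq0 (by positivity) (by
          have : |z - y| ≤ |z - t| + |t - y| := abs_sub_le _ _ _
          rw [abs_sub_comm t y] at this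
          linarith) e1
        refine this.trans (le_of_eq ?_)
        have e : 4 * (4 * B / r) / (r / 2) * (2 * r) ^ q = (32 * B * 2 ^ q) * (r ^ β) ^ p := by
          rw [← Real.rpow_mul hr0.le, Real.mul_rpow (by norm_num) hr0.le]
          have : β * p = q - 2 := by rw [hβ, hq]; field_simp; ring
          rw [this, Real.rpow_sub hr0]
          norm_num
          field_simp
          norm_num
        rw [e, Real.mul_rpow (by positivity) (by positivity), ← Real.rpow_mul (by positivity)]
        have : p * (1 / p) = 1 := by field_simp
        rw [this, Real.rpow_one]
      · exact fg_ptwise f p q _ _ t y hp0 hq0 (by positivity) (by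
          rw [abs_sub_comm]; exact hyt) e2
    intro k
    induction k with
    | zero =>
      obtain ⟨y, hy, h1, h2, h3⟩ := step 0 x hx (by simpa using hDx)
      exact ⟨y, hy, h1, by simpa using h2, h3⟩
    | succ k ih =>
      obtain ⟨z, hz, g1, g2, g3⟩ := ih
      obtain ⟨y, hy, h1, h2, h3⟩ := step (k + 1) z hz g1
      refine ⟨y, hy, h1, ?_, h3⟩
      rw [Finset.sum_range_succ]
      exact (norm_sub_le_norm_sub_add_norm_sub _ (f z) _).trans (add_le_add g2 h2)
  have hsum : ∀ n : ℕ, ∑ i ∈ Finset.range n, C * (h / 2 ^ i) ^ β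
      ≤ C * (1 - (1 / 2) ^ β)⁻¹ * h ^ β := by
    intro n
    have hlt : ((1 : ℝ) / 2) ^ β < 1 := Real.rpow_lt_one (by norm_num) (by norm_num) hβ0
    have hnn : 0 ≤ ((1 : ℝ) / 2) ^ β := by positivity
    have e : ∀ i : ℕ, C * (h / 2 ^ i) ^ β = C * h ^ β * (((1 : ℝ) / 2) ^ β) ^ i := by
      intro i
      have : h / 2 ^ i = h * (1 / 2) ^ i := by rw [one_div, inv_pow]; rfl
      rw [this, Real.mul_rpow hh.le (by positivity), mul_assoc,
        ← Real.rpow_natCast, ← Real.rpow_natCast, ← Real.rpow_mul (by norm_num),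
        ← Real.rpow_mul (by norm_num), mul_comm β]
    simp_rw [e]
    rw [← Finset.mul_sum]
    have : ∑ i ∈ Finset.range n, (((1 : ℝ) / 2) ^ β) ^ i ≤ (1 - (1 / 2) ^ β)⁻¹ := by
      rw [← tsum_geometric_of_lt_one hnn hlt]
      exact (summable_geometric_of_lt_one hnn hlt).sum_le_tsum _ (fun i _ => by positivity)
    calc _ ≤ C * h ^ β * (1 - (1 / 2) ^ β)⁻¹ := by gcongr
      _ = _ := by ring
  have hlim : Filter.Tendsto (fun k : ℕ =>
      C * (1 - (1 / 2) ^ β)⁻¹ * h ^ β +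
        (4 * d / (h / 2 ^ (k + 1)) * (h / 2 ^ (k + 1)) ^ q) ^ (1 / p)) Filter.atTop
      (nhds (C * (1 - (1 / 2) ^ β)⁻¹ * h ^ β + 0)) := by
    refine Filter.Tendsto.add tendsto_const_nhds ?_
    have e : ∀ k : ℕ, (4 * d / (h / 2 ^ (k + 1)) * (h / 2 ^ (k + 1)) ^ q) ^ (1 / p)
        = (4 * d * (h / 2 ^ (k + 1)) ^ (α * p)) ^ (1 / p) := by
      intro k
      have : 0 < h / 2 ^ (k + 1) := by positivity
      rw [hq, Real.rpow_add this, Real.rpow_one]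
      congr 1
      field_simp
    simp_rw [e]
    have h0 : Filter.Tendsto (fun k : ℕ => h / 2 ^ (k + 1)) Filter.atTop (nhds 0) := by
      have := (tendsto_pow_atTop_nhds_zero_of_lt_one (r := (1 : ℝ) / 2)
        (by norm_num) (by norm_num)).const_mul h
      rw [mul_zero] at this
      have := this.comp (Filter.tendsto_add_atTop_nat 1)
      refine this.congr fun k => ?_
      simp [div_eq_mul_inv]
    have h1 := h0.rpow_const (p := α * p) (Or.inr (by linarith))
    rw [Real.zero_rpow (by linarith)] at h1
    have h2 := (h1.const_mul (4 * d)).rpow_const (p := 1 / p) (Or.inr (by positivity))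
    rw [mul_zero, Real.zero_rpow (by positivity)] at h2
    exact h2
  rw [add_zero] at hlim
  refine ge_of_tendsto' hlim fun k => ?_
  obtain ⟨y, hy, h1, h2, h3⟩ := key k
  have := norm_sub_le_norm_sub_add_norm_sub (f t) (f y) (f x)
  rw [norm_sub_rev (f y)] at this
  have := hsum (k + 1)
  linarith

/-- The Hölder constant. -/
noncomputable def fgC (p α B : ℝ) : ℝ :=
  2 * ((32 * B * 2 ^ (1 + α * p)) ^ (1 / p) * (1 - (1 / 2) ^ (α - 1 / p))⁻¹)

lemma fg_pair {X : Type*} [NormedAddCommGroup X] (f : ℝ → X) (hf : StronglyMeasurable f)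
    (T p α B : ℝ) (hp : 1 < p) (hαp : 1 < α * p) (hB : 0 < B)
    (D : ℝ → ℝ≥0∞) (hD : D = fun t => ∫⁻ s in Set.Ioc 0 T, ((‖f t - f s‖₊ : ℝ≥0∞) ^ p /
            ENNReal.ofReal (|t - s| ^ (1 + α * p))))
    (hDm : Measurable D)
    (hDB : ∫⁻ t in Set.Ioc 0 T, D t ≤ ENNReal.ofReal B)
    (s t : ℝ) (hs : s ∈ Set.Ioc 0 T) (ht : t ∈ Set.Ioc 0 T) (hst : s < t)
    (hDs : D s ≠ ⊤) (hDt : D t ≠ ⊤) :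
    ‖f t - f s‖ ≤ fgC p α B * (t - s) ^ (α - 1 / p) := by
  have hh : 0 < t - s := sub_pos.2 hst
  have hk : ∀ k : ℕ, (t - s) / 2 ^ k ≤ t - s := fun k =>
    div_le_self hh.le (one_le_pow₀ (by norm_num))
  obtain ⟨x, hx, hxi⟩ := fg_select (Set.Ioc s t) (t - s) hh (by simp) (fun _ => D) (fun _ => hDm)
    (fun _ => B) (fun _ => hB) (fun _ => (lintegral_mono_set (by
      intro y hy; exact ⟨hs.1.trans hy.1, hy.2.trans ht.2⟩)).trans hDB)
  have hDx := hxi 0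
  have h1 := fg_chain f hf (Set.Ioc 0 T) p α B hp hαp hB D hD hDB t hDt
    (fun k => Set.Ioc (t - (t - s) / 2 ^ k) t) (t - s) hh
    (by
      intro k y hy
      have := hk k
      exact ⟨by linarith [hs.1, hy.1], hy.2.trans ht.2⟩)
    (by intro k; simp)
    (by
      intro k y hy
      rw [abs_le]
      have : 0 < (t - s) / 2 ^ k := by positivity
      constructor <;> linarith [hy.1, hy.2])
    x (by simpa using hx) hDx
  have h2 := fg_chain f hf (Set.Ioc 0 T) p α B hp hαp hB D hD hDB s hDs
    (fun k => Set.Ioc s (s + (t - s) / 2 ^ k)) (t - s) hh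
    (by
      intro k y hy
      have := hk k
      exact ⟨by linarith [hs.1, hy.1], by linarith [hy.2, ht.2]⟩)
    (by intro k; simp)
    (by
      intro k y hy
      rw [abs_le]
      have : 0 < (t - s) / 2 ^ k := by positivity
      constructor <;> linarith [hy.1, hy.2])
    x (by simpa using hx) hDx
  have := norm_sub_le_norm_sub_add_norm_sub (f t) (f x) (f s)
  rw [norm_sub_rev (f x)] at this
  unfold fgC
  linarith

lemma fg_full {X : Type*} [NormedAddCommGroup X] (f : ℝ → X)
    (T p α A B : ℝ) (hT : 0 < T) (hp : 1 < p) (hαp : 1 < α * p) (hA : 0 < A) (hB : 0 < B)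
    (hf : AEStronglyMeasurable f (volume.restrict (Set.Ioc 0 T)))
    (hfA : ∫⁻ t in Set.Ioc 0 T, (‖f t‖₊ : ℝ≥0∞) ^ p ≤ ENNReal.ofReal A)
    (hfB : ∫⁻ t in Set.Ioc 0 T, ∫⁻ s in Set.Ioc 0 T,
          ((‖f t - f s‖₊ : ℝ≥0∞) ^ p /
            ENNReal.ofReal (|t - s| ^ (1 + α * p))) ≤ ENNReal.ofReal B) :
    ∃ E ⊆ Set.Ioc 0 T, (∀ᵐ t ∂(volume.restrict (Set.Ioc 0 T)), t ∈ E) ∧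
      (∀ s ∈ E, ∀ t ∈ E, ‖f t - f s‖ ≤ fgC p α B * |t - s| ^ (α - 1 / p)) ∧
      (∀ t ∈ E, ‖f t‖ ≤ |fgC p α B| * T ^ (α - 1 / p) + (A * (2 / T)) ^ (1 / p)) := by
  have hp0 : 0 < p := by linarith
  have hβ0 : 0 < α - 1 / p := by
    have : 1 / p < α := by rw [div_lt_iff₀ hp0]; exact hαp
    linarith
  obtain ⟨f', hf', hff⟩ := hf
  set μ := volume.restrict (Set.Ioc 0 T) with hμ
  set D : ℝ → ℝ≥0∞ := fun t => ∫⁻ s in Set.Ioc 0 T, ((‖f' t - f' s‖₊ : ℝ≥0∞) ^ p /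
            ENNReal.ofReal (|t - s| ^ (1 + α * p))) with hD
  have hDm : Measurable D := by
    have hkm : Measurable (Function.uncurry fun t s : ℝ => ((‖f' t - f' s‖₊ : ℝ≥0∞) ^ p /
            ENNReal.ofReal (|t - s| ^ (1 + α * p)))) := by
      have h1 : StronglyMeasurable (fun z : ℝ × ℝ => f' z.1 - f' z.2) :=
        (hf'.comp_measurable measurable_fst).sub (hf'.comp_measurable measurable_snd)
      have h2 : Measurable fun z : ℝ × ℝ => (‖f' z.1 - f' z.2‖₊ : ℝ≥0∞) := h1.enorm
      have h3 : Measurable fun z : ℝ × ℝ => ENNReal.ofReal (|z.1 - z.2| ^ (1 + α * p)) := by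
        fun_prop
      exact (h2.pow_const p).div h3
    exact hkm.lintegral_prod_right
  have hDB : ∫⁻ t in Set.Ioc 0 T, D t ≤ ENNReal.ofReal B := by
    refine le_trans (le_of_eq ?_) hfB
    refine lintegral_congr_ae ?_
    filter_upwards [hff] with t ht
    refine lintegral_congr_ae ?_
    filter_upwards [hff] with s hs
    rw [ht, hs]
  have hDfin : ∀ᵐ t ∂μ, D t < ⊤ :=
    ae_lt_top hDm (ne_of_lt (hDB.trans_lt ENNReal.ofReal_lt_top))
  set E := {t | t ∈ Set.Ioc 0 T ∧ f t = f' t ∧ D t < ⊤} with hE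
  have hEae : ∀ᵐ t ∂μ, t ∈ E := by
    filter_upwards [hff, hDfin, ae_restrict_mem measurableSet_Ioc] with t h1 h2 h3
    exact ⟨h3, h1, h2⟩
  have hH : ∀ s ∈ E, ∀ t ∈ E, ‖f t - f s‖ ≤ fgC p α B * |t - s| ^ (α - 1 / p) := by
    rintro s ⟨hs, hs1, hs2⟩ t ⟨ht, ht1, ht2⟩
    rw [hs1, ht1]
    rcases lt_trichotomy s t with h | h | h
    · rw [abs_of_pos (sub_pos.2 h)]
      exact fg_pair f' hf' T p α B hp hαp hB D hD hDm hDB s t hs ht h hs2.ne ht2.ne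
    · subst h
      rw [sub_self, sub_self, norm_zero, abs_zero, Real.zero_rpow hβ0.ne', mul_zero]
    · rw [abs_sub_comm, norm_sub_rev, abs_of_pos (sub_pos.2 h)]
      exact fg_pair f' hf' T p α B hp hαp hB D hD hDm hDB t s ht hs h ht2.ne hs2.ne
  refine ⟨E, fun t ht => ht.1, hEae, hH, ?_⟩
  obtain ⟨s, hsE, hs⟩ : ∃ s ∈ E, (‖f s‖₊ : ℝ≥0∞) ^ p ≤ ENNReal.ofReal (A * (2 / T)) := by
    by_contra! hcon
    have h1 : ∫⁻ t in Set.Ioc 0 T, ENNReal.ofReal (A * (2 / T)) ≤ ENNReal.ofReal A := by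
      refine le_trans (lintegral_mono_ae ?_) hfA
      filter_upwards [hEae] with t ht
      exact (hcon t ht).le
    rw [setLIntegral_const, Real.volume_Ioc, ← ENNReal.ofReal_mul (by positivity),
      ENNReal.ofReal_le_ofReal_iff hA.le] at h1
    have : A * (2 / T) * (T - 0) = 2 * A := by field_simp; ring
    linarith
  have hs' : ‖f s‖ ≤ (A * (2 / T)) ^ (1 / p) := by
    have h2 : (‖f s‖₊ : ℝ≥0∞) = ENNReal.ofReal ‖f s‖ := by
      rw [ofReal_norm]; rfl
    rw [h2, ENNReal.ofReal_rpow_of_nonneg (norm_nonneg _) hp0.le,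
      ENNReal.ofReal_le_ofReal_iff (by positivity)] at hs
    calc ‖f s‖ = (‖f s‖ ^ p) ^ (1 / p) := by
          rw [← Real.rpow_mul (norm_nonneg _)]; field_simp; simp
      _ ≤ _ := by gcongr
  intro t ht
  have h1 := hH s hsE t ht
  have h2 : fgC p α B * |t - s| ^ (α - 1 / p) ≤ |fgC p α B| * T ^ (α - 1 / p) := by
    have : |t - s| ≤ T := by
      rw [abs_le]
      constructor <;> linarith [ht.1.1, ht.1.2, hsE.1.1, hsE.1.2]
    gcongr
    exact le_abs_self _
  have h3 : ‖f t‖ ≤ ‖f t - f s‖ + ‖f s‖ := by simpa using norm_add_le (f t - f s) (f s)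
  linarith

lemma fg_dense (T : ℝ) (hT : 0 < T) (E : Set ℝ)
    (hE : ∀ᵐ t ∂(volume.restrict (Set.Ioc 0 T)), t ∈ E) : Set.Icc 0 T ⊆ closure E := by
  rw [← closure_Ioo hT.ne]
  refine closure_minimal ?_ isClosed_closure
  intro t ht
  rw [mem_closure_iff]
  intro o ho hto
  by_contra hcon
  rw [Set.not_nonempty_iff_eq_empty] at hcon
  have hopen : IsOpen (o ∩ Set.Ioo 0 T) := ho.inter isOpen_Ioo
  have hpos := hopen.measure_pos volume ⟨t, hto, ht⟩
  rw [ae_restrict_iff' measurableSet_Ioc] at hE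
  have h0 : volume (o ∩ Set.Ioo 0 T) = 0 := by
    refine measure_mono_null ?_ (ae_iff.1 hE)
    rintro y ⟨hy, hy'⟩
    simp only [Set.mem_ofPred_eq, Classical.not_imp]
    refine ⟨⟨hy'.1, hy'.2.le⟩, fun hyE => ?_⟩
    have : y ∈ o ∩ E := ⟨hy, hyE⟩
    rw [hcon] at this
    exact this
  exact hpos.ne' h0

lemma fg_extend {Y : Type*} [NormedAddCommGroup Y] (u : ℝ → Y) (E I : Set ℝ) (hI : I ⊆ closure E)
    (hEI : E ⊆ I) (K : Set Y) (hK : IsCompact K) (huK : ∀ t ∈ E, u t ∈ K) (C β : ℝ) (hβ : 0 < β)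
    (hu : ∀ s ∈ E, ∀ t ∈ E, ‖u t - u s‖ ≤ C * |t - s| ^ β) :
    ∃ g : ℝ → Y, ContinuousOn g I ∧ (∀ t ∈ E, g t = u t) ∧ (∀ t ∈ I, g t ∈ K) ∧
      ∀ s ∈ I, ∀ t ∈ I, ‖g t - g s‖ ≤ C * |t - s| ^ β := by
  have hmod : Filter.Tendsto (fun z : ℝ × ℝ => C * |z.1 - z.2| ^ β) (uniformity ℝ) (nhds 0) := by
    have h1 : Filter.Tendsto (fun z : ℝ × ℝ => dist z.1 z.2) (uniformity ℝ) (nhds 0) :=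
      tendsto_uniformity_iff_dist_tendsto_zero.1 Filter.tendsto_id
    have h2 := (h1.rpow_const (p := β) (Or.inr hβ.le)).const_mul C
    rw [Real.zero_rpow hβ.ne', mul_zero] at h2
    exact h2
  have huc : UniformContinuousOn u E := by
    rw [Metric.uniformContinuousOn_iff]
    intro ε hε
    have h1 := hmod.eventually (gt_mem_nhds hε)
    obtain ⟨δ, hδ, h2⟩ := Metric.mem_uniformity_dist.1 h1
    refine ⟨δ, hδ, fun s hs t ht hst => ?_⟩
    rw [dist_eq_norm]
    exact (hu t ht s hs).trans_lt (h2 hst)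
  have hlim : ∀ x ∈ I, ∃ y, Filter.Tendsto u (nhdsWithin x E) (nhds y) := by
    intro x hx
    haveI := mem_closure_iff_nhdsWithin_neBot.mp (hI hx)
    have hc : Cauchy (Filter.map u (nhdsWithin x E)) := by
      refine Cauchy.map_of_le (cauchy_nhds.mono nhdsWithin_le_nhds) huc ?_
      exact Filter.le_principal_iff.2 self_mem_nhdsWithin
    obtain ⟨y, -, hy⟩ := hK.isComplete _ hc (by
      rw [Filter.le_principal_iff, Filter.mem_map]
      filter_upwards [self_mem_nhdsWithin] with t ht using huK t ht)
    exact ⟨y, hy⟩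
  have hcont := continuousOn_extendFrom hI hlim
  have hext := extendFrom_extends huc.continuousOn
  refine ⟨extendFrom E u, hcont, hext, ?_, ?_⟩
  · intro t ht
    haveI := mem_closure_iff_nhdsWithin_neBot.mp (hI ht)
    refine hK.isClosed.mem_of_tendsto ((hcont t ht).mono hEI) ?_
    filter_upwards [self_mem_nhdsWithin] with s hs
    rw [hext s hs]; exact huK s hs
  · intro s hs t ht
    haveI := mem_closure_iff_nhdsWithin_neBot.mp (hI hs)
    haveI := mem_closure_iff_nhdsWithin_neBot.mp (hI ht)
    have h1 : Filter.Tendsto (extendFrom E u) (nhdsWithin s E) (nhds (extendFrom E u s)) :=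
      (hcont s hs).mono hEI
    have h2 : Filter.Tendsto (extendFrom E u) (nhdsWithin t E) (nhds (extendFrom E u t)) :=
      (hcont t ht).mono hEI
    have h3 := ((h2.comp Filter.tendsto_snd).sub
      (h1.comp (Filter.tendsto_fst (g := nhdsWithin t E)))).norm
    have a1 : Filter.Tendsto (fun z : ℝ => z) (nhdsWithin s E) (nhds s) := nhdsWithin_le_nhds
    have a2 : Filter.Tendsto (fun z : ℝ => z) (nhdsWithin t E) (nhds t) := nhdsWithin_le_nhds
    have h4 := ((((a2.comp Filter.tendsto_snd).sub
      (a1.comp (Filter.tendsto_fst (g := nhdsWithin t E)))).abs).rpow_const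
        (p := β) (Or.inr hβ.le)).const_mul C
    refine le_of_tendsto_of_tendsto h3 h4 ?_
    have e1 : ∀ᶠ z : ℝ × ℝ in nhdsWithin s E ×ˢ nhdsWithin t E, z.1 ∈ E ∧ z.2 ∈ E :=
      Filter.Eventually.prod_mk (pa := fun a => a ∈ E) self_mem_nhdsWithin
        (pb := fun a => a ∈ E) self_mem_nhdsWithin
    filter_upwards [e1] with z hz
    simp only [Function.comp]
    rw [hext _ hz.1, hext _ hz.2]
    exact hu _ hz.1 _ hz.2

lemma fg_ascoli {Y : Type*} [NormedAddCommGroup Y] (T : ℝ) (hT : 0 < T) (g : ℕ → ℝ → Y)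
    (hg : ∀ n, ContinuousOn (g n) (Set.Icc 0 T)) (K : Set Y) (hK : IsCompact K)
    (hgK : ∀ n, ∀ t ∈ Set.Icc 0 T, g n t ∈ K) (C β : ℝ) (hβ : 0 < β)
    (hgH : ∀ n, ∀ s ∈ Set.Icc 0 T, ∀ t ∈ Set.Icc 0 T, ‖g n t - g n s‖ ≤ C * |t - s| ^ β) :
    ∃ φ : ℕ → ℕ, StrictMono φ ∧ ∃ glim : ℝ → Y,
        ContinuousOn glim (Set.Icc 0 T) ∧
        TendstoUniformlyOn (fun k => g (φ k)) glim Filter.atTop (Set.Icc 0 T) := by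
  let G : ℕ → BoundedContinuousFunction (Set.Icc 0 T) Y := fun n =>
    BoundedContinuousFunction.mkOfCompact ⟨fun t => g n t, (hg n).domRestrict⟩
  have hGa : ∀ n t, G n t = g n t := fun n t => rfl
  have hcomp : IsCompact (closure (Set.range G)) := by
    refine BoundedContinuousFunction.arzela_ascoli K hK _ ?_ ?_
    · rintro _ x ⟨n, rfl⟩
      exact hgK n x x.2
    · refine Metric.equicontinuous_of_continuity_modulus (fun r => C * |r| ^ β) ?_ _ ?_
      · have h1 : Filter.Tendsto (fun r : ℝ => |r|) (nhds 0) (nhds 0) := by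
          simpa using (continuous_abs (G := ℝ)).tendsto 0
        have h2 := (h1.rpow_const (p := β) (Or.inr hβ.le)).const_mul C
        rwa [Real.zero_rpow hβ.ne', mul_zero] at h2
      · rintro x y ⟨_, n, rfl⟩
        rw [abs_of_nonneg dist_nonneg, dist_eq_norm]
        exact hgH n y y.2 x x.2
  obtain ⟨G', -, φ, hφ, hlim⟩ := hcomp.tendsto_subseq
    (x := G) (fun n => subset_closure ⟨n, rfl⟩)
  refine ⟨φ, hφ, Set.IccExtend hT.le G', ?_, ?_⟩
  · exact (G'.continuous.Icc_extend').continuousOn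
  · have := BoundedContinuousFunction.tendsto_iff_tendstoUniformly.1 hlim
    rw [Metric.tendstoUniformly_iff] at this
    rw [Metric.tendstoUniformlyOn_iff]
    intro ε hε
    filter_upwards [this ε hε] with k hk t ht
    rw [Set.IccExtend_of_mem _ _ ht]
    exact hk ⟨t, ht⟩


/-- Flandoli–Gatarek compact embedding `W^{α,p}(0,T;X₀) ⊂⊂ C([0,T];X₁)` for `αp > 1`:
if `ι : X₀ → X₁` is a compact embedding and `fₙ : [0,T] → X₀` is a sequence bounded in
`W^{α,p}(0,T;X₀)`, then each `ι ∘ fₙ` has a continuous representative `gₙ` on `[0,T]`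
and a subsequence of `(gₙ)` converges uniformly on `[0,T]` to a continuous function. -/
theorem flandoli_gatarek_compact_embedding_into_continuous
    {X0 X1 : Type*} [NormedAddCommGroup X0] [NormedSpace ℝ X0]
    [NormedAddCommGroup X1] [NormedSpace ℝ X1]
    (ι : X0 →L[ℝ] X1) (hinj : Function.Injective ι)
    (hcpt : ∀ s : Set X0, Bornology.IsBounded s → IsCompact (closure (ι '' s)))
    (T : ℝ) (hT : 0 < T) (p : ℝ) (hp : 1 < p)
    (α : ℝ) (hα : α ∈ Set.Ioo (0 : ℝ) 1) (hαp : 1 < α * p)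
    (f : ℕ → ℝ → X0)
    (hmeas : ∀ n, AEStronglyMeasurable (f n) (volume.restrict (Set.Ioc 0 T)))
    (hbdd : ∃ M : ℝ≥0∞, M ≠ ⊤ ∧ ∀ n,
      (∫⁻ t in Set.Ioc 0 T, (‖f n t‖₊ : ℝ≥0∞) ^ p) ^ (1 / p) +
      (∫⁻ t in Set.Ioc 0 T, ∫⁻ s in Set.Ioc 0 T,
          ((‖f n t - f n s‖₊ : ℝ≥0∞) ^ p /
            ENNReal.ofReal (|t - s| ^ (1 + α * p)))) ^ (1 / p) ≤ M) :
    ∃ g : ℕ → ℝ → X1,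
      (∀ n, ContinuousOn (g n) (Set.Icc 0 T)) ∧
      (∀ n, ∀ᵐ t ∂(volume.restrict (Set.Ioc 0 T)), g n t = ι (f n t)) ∧
      ∃ φ : ℕ → ℕ, StrictMono φ ∧ ∃ glim : ℝ → X1,
        ContinuousOn glim (Set.Icc 0 T) ∧
        TendstoUniformlyOn (fun k => g (φ k)) glim Filter.atTop (Set.Icc 0 T) := by
  obtain ⟨M, hM, hbd⟩ := hbdd
  have hp0 : 0 < p := by linarith
  have hβ0 : 0 < α - 1 / p := by
    have : 1 / p < α := by rw [div_lt_iff₀ hp0]; exact hαp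
    linarith
  obtain ⟨B, hB0, hB⟩ : ∃ B : ℝ, 0 < B ∧ M ^ p ≤ ENNReal.ofReal B := by
    have : M ^ p ≠ ⊤ := by simp [hM, hp0.le]
    refine ⟨(M ^ p).toReal + 1, by positivity, ?_⟩
    rw [ENNReal.le_ofReal_iff_toReal_le this (by positivity)]
    linarith
  have hroot : ∀ a : ℝ≥0∞, a ^ (1 / p) ≤ M → a ≤ ENNReal.ofReal B := by
    intro a ha
    refine le_trans ?_ hB
    calc a = (a ^ (1 / p)) ^ p := by
          rw [← ENNReal.rpow_mul, one_div_mul_cancel hp0.ne', ENNReal.rpow_one]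
      _ ≤ M ^ p := ENNReal.rpow_le_rpow ha hp0.le
  have hfull := fun n => fg_full (f n) T p α B B hT hp hαp hB0 hB0 (hmeas n)
    (hroot _ (le_self_add.trans (hbd n))) (hroot _ (le_add_self.trans (hbd n)))
  choose E hE0 hEae hEH hEb using hfull
  set R := |fgC p α B| * T ^ (α - 1 / p) + (B * (2 / T)) ^ (1 / p) with hR
  have hK := hcpt (Metric.closedBall 0 R) Metric.isBounded_closedBall
  have hext := fun n => fg_extend (fun t => ι (f n t)) (E n) (Set.Icc 0 T)
    (fg_dense T hT (E n) (hEae n)) ((hE0 n).trans Set.Ioc_subset_Icc_self) _ hK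
    (fun t ht => subset_closure ⟨f n t, by simpa using hEb n t ht, rfl⟩)
    (‖ι‖ * fgC p α B) (α - 1 / p) hβ0
    (by
      intro s hs t ht
      rw [← map_sub, mul_assoc]
      exact (ι.le_opNorm _).trans (by gcongr; exact hEH n s hs t ht))
  choose g hg1 hg2 hg3 hg4 using hext
  refine ⟨g, hg1, fun n => ?_, fg_ascoli T hT g hg1 _ hK hg3 _ _ hβ0 hg4⟩
  filter_upwards [hEae n] with t ht using hg2 n t ht
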